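/- Let N ≥ 1, ε > 0, and let V : ℝ × ℝ^N → ℝ^N be a continuous time-dependent vector field, uniformly Lipschitz in space on [0,ε], with each V(t,·) continuously differentiable and (t,x) ↦ D_xV(t,x) continuous, and let T_t be its flow; assume furthermore that each T_t is continuously differentiable with t ↦ D_X T_t(X) continuously differentiable and solving the variational equation d/dt D_X T_t(X) = D_xV(t,T_t(X)) ∘ D_X T_t(X), D_X T_0(X) = I. Let Ω ⊆ ℝ^N be a bounded measurable set and let F : ℝ × ℝ^N → ℝ be continuously differentiable. Then the function t ↦ ∫_{T_t(Ω)} F(t,x) dx is differentiable at t = 0 and d/dt ∫_{T_t(Ω)} F(t,x) dx |_{t=0} = ∫_Ω [ ∂_t F(0,x) + ∇_x F(0,x) · V(0,x) + F(0,x) · (div V)(0,x) ] dx, where div V(0,x) := trace(D_xV(0,x)). -/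

import Mathlib

open Set MeasureTheory

open Filter Topology in
lemma hasFDerivAt_det_id (N : ℕ) :
    ∃ D : (EuclideanSpace ℝ (Fin N) →L[ℝ] EuclideanSpace ℝ (Fin N)) →L[ℝ] ℝ,
      HasFDerivAt (fun A : EuclideanSpace ℝ (Fin N) →L[ℝ] EuclideanSpace ℝ (Fin N) => A.det) D
        (ContinuousLinearMap.id ℝ _) ∧
      ∀ A, D A = LinearMap.trace ℝ (EuclideanSpace ℝ (Fin N))
        (A : EuclideanSpace ℝ (Fin N) →ₗ[ℝ] EuclideanSpace ℝ (Fin N)) := by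
  let b := (EuclideanSpace.basisFun (Fin N) ℝ).toBasis
  have hdet : ∀ A : EuclideanSpace ℝ (Fin N) →L[ℝ] EuclideanSpace ℝ (Fin N),
      A.det = (LinearMap.toMatrix b b (A : EuclideanSpace ℝ (Fin N) →ₗ[ℝ] _)).det := by
    intro A
    exact (LinearMap.det_toMatrix b _).symm
  have hdiff : Differentiable ℝ
      (fun A : EuclideanSpace ℝ (Fin N) →L[ℝ] EuclideanSpace ℝ (Fin N) => A.det) := by
    simp only [hdet, Matrix.det_apply]
    have he : ∀ i j, Differentiable ℝ
      (fun A : EuclideanSpace ℝ (Fin N) →L[ℝ] EuclideanSpace ℝ (Fin N) =>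
        LinearMap.toMatrix b b (A : EuclideanSpace ℝ (Fin N) →ₗ[ℝ] _) i j) := by
      intro i j
      have : (fun A : EuclideanSpace ℝ (Fin N) →L[ℝ] EuclideanSpace ℝ (Fin N) =>
        LinearMap.toMatrix b b (A : EuclideanSpace ℝ (Fin N) →ₗ[ℝ] _) i j)
        = fun A => (EuclideanSpace.proj i : EuclideanSpace ℝ (Fin N) →L[ℝ] ℝ) (A (b j)) := by
        funext A
        simp [LinearMap.toMatrix_apply, b]
      rw [this]
      fun_prop
    refine Differentiable.fun_sum fun σ _ => Differentiable.const_smul ?_ _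
    intro A
    exact (HasFDerivAt.finsetProd (fun i _ => (he (σ i) i A).hasFDerivAt)).differentiableAt
  refine ⟨_, (hdiff _).hasFDerivAt, fun A => ?_⟩
  have h1 := ((hdiff (ContinuousLinearMap.id ℝ (EuclideanSpace ℝ (Fin N)))).hasFDerivAt.hasLineDerivAt A)
  have h1 : HasDerivAt (fun t : ℝ => (ContinuousLinearMap.id ℝ (EuclideanSpace ℝ (Fin N)) + t • A).det) _ 0 := h1
  refine h1.unique ?_
  set M := LinearMap.toMatrix b b (A : EuclideanSpace ℝ (Fin N) →ₗ[ℝ] _) with hM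
  have htr : LinearMap.trace ℝ (EuclideanSpace ℝ (Fin N))
        (A : EuclideanSpace ℝ (Fin N) →ₗ[ℝ] EuclideanSpace ℝ (Fin N)) = M.trace :=
    LinearMap.trace_eq_matrix_trace ℝ b _
  have hfun : (fun t : ℝ => (ContinuousLinearMap.id ℝ (EuclideanSpace ℝ (Fin N)) + t • A).det)
     = fun t : ℝ => 1 + M.trace * t + (Matrix.det (1 + (Polynomial.X : Polynomial ℝ) • M.map Polynomial.C)).divX.divX.eval t * t ^ 2 := by
    funext t
    rw [hdet, ← Matrix.det_one_add_smul]
    congr 1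
    simp [hM]
  rw [htr, hfun]
  have := (((hasDerivAt_id (0:ℝ)).const_mul M.trace).const_add 1).add
    ((Polynomial.hasDerivAt (Matrix.det (1 + (Polynomial.X : Polynomial ℝ) • M.map Polynomial.C)).divX.divX 0).mul ((hasDerivAt_id (0:ℝ)).pow 2))
  convert this using 1
  · funext t
    simp
  · simp

open Filter Topology in
/-- Differentiation under the integral sign, one-sided version. -/
lemma hasDerivWithinAt_integral_of_lip {α : Type*} [MeasurableSpace α] {μ : Measure α}
    [IsFiniteMeasure μ] (s : Set ℝ) (g : ℝ → α → ℝ) (g' : α → ℝ) (C : ℝ)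
    (hint : ∀ t ∈ s, Integrable (g t) μ) (h0 : (0 : ℝ) ∈ s)
    (hb : ∀ᶠ t in 𝓝[s] (0 : ℝ), ∀ᵐ x ∂μ, |g t x - g 0 x| ≤ C * |t|)
    (hd : ∀ᵐ x ∂μ, HasDerivWithinAt (fun t => g t x) (g' x) s 0) :
    HasDerivWithinAt (fun t => ∫ x, g t x ∂μ) (∫ x, g' x ∂μ) s 0 := by
  rw [hasDerivWithinAt_iff_tendsto_slope]
  have hle : 𝓝[s \ {0}] (0:ℝ) ≤ 𝓝[s] 0 := nhdsWithin_mono _ sdiff_subset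
  have hmem : ∀ᶠ t in 𝓝[s \ {0}] (0:ℝ), t ∈ s \ {0} := self_mem_nhdsWithin
  have key : Tendsto (fun t => ∫ x, slope (fun t => g t x) 0 t ∂μ) (𝓝[s \ {0}] 0)
      (𝓝 (∫ x, g' x ∂μ)) := by
    refine tendsto_integral_filter_of_dominated_convergence (fun _ => C) ?_ ?_
      (integrable_const _) ?_
    · filter_upwards [hmem] with t ht
      simp only [slope_def_field]
      exact (((hint t ht.1).sub (hint 0 h0)).div_const _).aestronglyMeasurable
    · filter_upwards [hmem, hle hb] with t ht h
      filter_upwards [h] with x hx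
      have : 0 < |t| := abs_pos.2 ht.2
      rw [slope_def_field, sub_zero, norm_div, Real.norm_eq_abs, Real.norm_eq_abs,
        div_le_iff₀ this]
      exact hx
    · filter_upwards [hd] with x hx
      exact hasDerivWithinAt_iff_tendsto_slope.1 hx
  refine key.congr' ?_
  filter_upwards [hmem] with t ht
  simp only [slope_def_field]
  rw [integral_div, integral_sub (hint t ht.1) (hint 0 h0)]

section flow
open Filter Topology
variable {E : Type*} [NormedAddCommGroup E] [NormedSpace ℝ E]

lemma flow_hasDeriv_Ici {f : ℝ → E} {f' : E} {ε t : ℝ} (ht : t ∈ Ico (0:ℝ) ε)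
    (h : HasDerivWithinAt f f' (Icc 0 ε) t) : HasDerivWithinAt f f' (Ici t) t :=
  h.mono_of_mem_nhdsWithin (Icc_mem_nhdsGE_of_mem ht)

lemma flow_hasDeriv_Iic {f : ℝ → E} {f' : E} {ε t : ℝ} (ht : t ∈ Ioc (0:ℝ) ε)
    (h : HasDerivWithinAt f f' (Icc 0 ε) t) : HasDerivWithinAt f f' (Iic t) t :=
  h.mono_of_mem_nhdsWithin (Icc_mem_nhdsLE_of_mem ht)

lemma flow_injective (ε L : ℝ) (hL : 0 ≤ L) (V T : ℝ → E → E)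
    (hVlip : ∀ t ∈ Icc (0 : ℝ) ε, ∀ x y : E, ‖V t x - V t y‖ ≤ L * ‖x - y‖)
    (hTflow : ∀ X : E, T 0 X = X ∧ ∀ t ∈ Icc (0 : ℝ) ε,
        HasDerivWithinAt (fun s => T s X) (V t (T t X)) (Icc (0 : ℝ) ε) t)
    (t : ℝ) (ht : t ∈ Icc 0 ε) : Function.Injective (T t) := by
  intro X Y hXY
  have hsub : Icc 0 t ⊆ Icc 0 ε := Icc_subset_Icc_right ht.2
  have hd : ∀ Z : E, ∀ s ∈ Icc 0 t, HasDerivWithinAt (fun s => T s Z) (V s (T s Z)) (Icc 0 t) s :=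
    fun Z s hs => ((hTflow Z).2 s (hsub hs)).mono hsub
  have := ODE_solution_unique_of_mem_Icc_left (v := V) (s := fun _ => univ) (K := ⟨L, hL⟩)
    (f := fun s => T s X) (g := fun s => T s Y) (a := 0) (b := t)
    (fun s hs => (LipschitzWith.of_dist_le_mul fun x y => by
      rw [dist_eq_norm, dist_eq_norm]
      exact hVlip s (hsub (Ioc_subset_Icc_self hs)) x y).lipschitzOnWith)
    (fun s hs => (hd X s hs).continuousWithinAt)
    (fun s hs => flow_hasDeriv_Iic hs (hd X s (Ioc_subset_Icc_self hs)))
    (fun _ _ => trivial)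
    (fun s hs => (hd Y s hs).continuousWithinAt)
    (fun s hs => flow_hasDeriv_Iic hs (hd Y s (Ioc_subset_Icc_self hs)))
    (fun _ _ => trivial) hXY
  have h0 := this (left_mem_Icc.2 ht.1)
  simpa [(hTflow X).1, (hTflow Y).1] using h0

lemma flow_bounded (ε L : ℝ) (hL : 0 ≤ L) (hε : 0 < ε) (V T : ℝ → E → E)
    (hVlip : ∀ t ∈ Icc (0 : ℝ) ε, ∀ x y : E, ‖V t x - V t y‖ ≤ L * ‖x - y‖)
    (hTflow : ∀ X : E, T 0 X = X ∧ ∀ t ∈ Icc (0 : ℝ) ε,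
        HasDerivWithinAt (fun s => T s X) (V t (T t X)) (Icc (0 : ℝ) ε) t)
    (R : ℝ) (hR : 0 ≤ R) : ∃ M, 0 ≤ M ∧ ∀ t ∈ Icc (0:ℝ) ε, ∀ X, ‖X‖ ≤ R → ‖T t X‖ ≤ M := by
  have hc : ∀ Z, ContinuousOn (fun s => T s Z) (Icc 0 ε) :=
    fun Z s hs => ((hTflow Z).2 s hs).continuousWithinAt
  obtain ⟨B, hB⟩ := isCompact_Icc.exists_bound_of_continuousOn (hc 0)
  have hB0 : 0 ≤ B := (norm_nonneg _).trans (hB 0 (left_mem_Icc.2 hε.le))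
  refine ⟨B + R * Real.exp (L * ε), by positivity, fun t ht X hX => ?_⟩
  have := dist_le_of_trajectories_ODE_of_mem (v := V) (s := fun _ => univ) (K := ⟨L, hL⟩)
    (f := fun s => T s X) (g := fun s => T s 0) (a := 0) (b := ε) (δ := R)
    (fun s hs => (LipschitzWith.of_dist_le_mul fun x y => by
      rw [dist_eq_norm, dist_eq_norm]
      exact hVlip s ((Ico_subset_Icc_self hs)) x y).lipschitzOnWith)
    (hc X)
    (fun s hs => flow_hasDeriv_Ici hs ((hTflow X).2 s (Ico_subset_Icc_self hs)))
    (fun _ _ => trivial)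
    (hc 0)
    (fun s hs => flow_hasDeriv_Ici hs ((hTflow 0).2 s (Ico_subset_Icc_self hs)))
    (fun _ _ => trivial) (by simpa [(hTflow X).1, (hTflow 0).1] using hX) t ht
  have h2 : R * Real.exp (L * (t - 0)) ≤ R * Real.exp (L * ε) := by
    have := ht.2
    gcongr
    linarith
  have h3 : ‖T t X - T t 0‖ ≤ R * Real.exp (L * (t - 0)) := by
    rw [← dist_eq_norm]; exact this
  have h4 := hB t ht
  have h5 : ‖T t X‖ ≤ ‖T t 0‖ + ‖T t X - T t 0‖ := by
    simpa using norm_add_le (T t 0) (T t X - T t 0)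
  linarith

lemma variational_bound (ε L : ℝ) (hL : 0 ≤ L)
    (A W : ℝ → E →L[ℝ] E) (hA0 : A 0 = ContinuousLinearMap.id ℝ E)
    (hW : ∀ t ∈ Icc (0:ℝ) ε, ‖W t‖ ≤ L)
    (hA : ∀ t ∈ Icc (0:ℝ) ε, HasDerivWithinAt A ((W t).comp (A t)) (Icc 0 ε) t) :
    ∀ t ∈ Icc (0:ℝ) ε, ‖A t - ContinuousLinearMap.id ℝ E‖ ≤ L * Real.exp (L * ε) * t := by
  have h1 : ∀ t ∈ Icc (0:ℝ) ε, ‖A t‖ ≤ Real.exp (L * ε) := by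
    intro t ht
    have := norm_le_gronwallBound_of_norm_deriv_right_le (f := A) (δ := 1) (K := L) (ε := 0)
      (a := 0) (b := ε) (fun s hs => (hA s hs).continuousWithinAt)
      (fun s hs => flow_hasDeriv_Ici hs (hA s (Ico_subset_Icc_self hs)))
      (by rw [hA0]; exact ContinuousLinearMap.norm_id_le)
      (fun s hs => by
        rw [add_zero]
        exact (ContinuousLinearMap.opNorm_comp_le _ _).trans
          (mul_le_mul_of_nonneg_right (hW s (Ico_subset_Icc_self hs)) (norm_nonneg _))) t ht
    rw [gronwallBound_ε0, one_mul, sub_zero] at this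
    refine this.trans (Real.exp_le_exp.2 ?_)
    exact mul_le_mul_of_nonneg_left ht.2 hL
  intro t ht
  have := norm_image_sub_le_of_norm_deriv_le_segment' hA (C := L * Real.exp (L * ε))
    (fun s hs => (ContinuousLinearMap.opNorm_comp_le _ _).trans
      (mul_le_mul (hW s (Ico_subset_Icc_self hs)) (h1 s (Ico_subset_Icc_self hs)) (norm_nonneg _) hL)) t ht
  rwa [hA0, sub_zero] at this
end flow

open Filter Topology in


/-- Hadamard's formula (volume-integral form): for the flow `T` of a
time-dependent vector field `V` (satisfying the variational equation), a
bounded measurable set `Ω ⊆ ℝ^N` and a `C¹` integrand `F`, the function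
`t ↦ ∫_{T_t(Ω)} F(t,x) dx` is differentiable at `t = 0` with derivative
`∫_Ω [∂_t F(0,x) + ∇_x F(0,x) · V(0,x) + F(0,x) (div V)(0,x)] dx`. -/
theorem hadamard_formula_volume
    (N : ℕ) (hN : 1 ≤ N) (ε : ℝ) (hε : 0 < ε)
    (V : ℝ → EuclideanSpace ℝ (Fin N) → EuclideanSpace ℝ (Fin N))
    (hVcont : Continuous fun p : ℝ × EuclideanSpace ℝ (Fin N) => V p.1 p.2)
    (L : ℝ) (hL : 0 ≤ L)
    (hVlip : ∀ t ∈ Icc (0 : ℝ) ε, ∀ x y : EuclideanSpace ℝ (Fin N),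
      ‖V t x - V t y‖ ≤ L * ‖x - y‖)
    (hVC1 : ∀ t : ℝ, ContDiff ℝ 1 (V t))
    (hDVcont : ContinuousOn
      (fun p : ℝ × EuclideanSpace ℝ (Fin N) => fderiv ℝ (V p.1) p.2)
      (Icc (0 : ℝ) ε ×ˢ (univ : Set (EuclideanSpace ℝ (Fin N)))))
    (T : ℝ → EuclideanSpace ℝ (Fin N) → EuclideanSpace ℝ (Fin N))
    (hTflow : ∀ X : EuclideanSpace ℝ (Fin N), T 0 X = X ∧
      ∀ t ∈ Icc (0 : ℝ) ε,
        HasDerivWithinAt (fun s => T s X) (V t (T t X)) (Icc (0 : ℝ) ε) t)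
    (hTC1 : ∀ t ∈ Icc (0 : ℝ) ε, ContDiff ℝ 1 (T t))
    (hvar : ∀ X : EuclideanSpace ℝ (Fin N),
      fderiv ℝ (T 0) X = ContinuousLinearMap.id ℝ (EuclideanSpace ℝ (Fin N)) ∧
      (∀ t ∈ Icc (0 : ℝ) ε,
        HasDerivWithinAt (fun s => fderiv ℝ (T s) X)
          ((fderiv ℝ (V t) (T t X)).comp (fderiv ℝ (T t) X)) (Icc (0 : ℝ) ε) t) ∧
      ContinuousOn
        (fun t : ℝ => (fderiv ℝ (V t) (T t X)).comp (fderiv ℝ (T t) X))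
        (Icc (0 : ℝ) ε))
    (Ω : Set (EuclideanSpace ℝ (Fin N)))
    (hΩmeas : MeasurableSet Ω) (hΩbdd : Bornology.IsBounded Ω)
    (F : ℝ → EuclideanSpace ℝ (Fin N) → ℝ)
    (hF : ContDiff ℝ 1 (fun p : ℝ × EuclideanSpace ℝ (Fin N) => F p.1 p.2)) :
    HasDerivWithinAt (fun t : ℝ => ∫ x in T t '' Ω, F t x)
      (∫ x in Ω,
        (deriv (fun s : ℝ => F s x) 0
          + fderiv ℝ (F 0) x (V 0 x)
          + F 0 x * LinearMap.trace ℝ (EuclideanSpace ℝ (Fin N))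
              (fderiv ℝ (V 0) x :
                EuclideanSpace ℝ (Fin N) →ₗ[ℝ] EuclideanSpace ℝ (Fin N))))
      (Icc (0 : ℝ) ε) 0 := by
  classical
  obtain ⟨R0, hR0⟩ := hΩbdd.subset_closedBall 0
  obtain ⟨R, hR, hΩR⟩ : ∃ R : ℝ, 0 ≤ R ∧ ∀ X ∈ Ω, ‖X‖ ≤ R :=
    ⟨max R0 0, le_max_right _ _, fun X hX => by
      have := hR0 hX
      rw [mem_closedBall_zero_iff] at this
      exact this.trans (le_max_left _ _)⟩
  obtain ⟨M, hM0, hM⟩ := flow_bounded ε L hL hε V T hVlip hTflow R hR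
  have h0ε : (0 : ℝ) ∈ Icc (0 : ℝ) ε := left_mem_Icc.2 hε.le
  obtain ⟨D, hD, hDtr⟩ := hasFDerivAt_det_id N
  have hDV : ∀ t ∈ Icc (0 : ℝ) ε, ∀ x, ‖fderiv ℝ (V t) x‖ ≤ L := fun t ht x =>
    norm_fderiv_le_of_lip' ℝ hL (Filter.Eventually.of_forall fun y => hVlip t ht y x)
  have hA : ∀ t ∈ Icc (0 : ℝ) ε, ∀ X,
      ‖fderiv ℝ (T t) X - ContinuousLinearMap.id ℝ (EuclideanSpace ℝ (Fin N))‖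
        ≤ L * Real.exp (L * ε) * t := fun t ht X =>
    variational_bound ε L hL (fun s => fderiv ℝ (T s) X) (fun s => fderiv ℝ (V s) (T s X))
      (hvar X).1 (fun s hs => hDV s hs _) (hvar X).2.1 t ht
  -- determinant bound
  obtain ⟨c, hc0, hc⟩ := hD.isBigO_sub.exists_pos
  have hc := hc.bound
  obtain ⟨r, hr, hball⟩ := Metric.eventually_nhds_iff.1 hc
  have hdetid : (ContinuousLinearMap.id ℝ (EuclideanSpace ℝ (Fin N))).det = 1 := by
    simp [ContinuousLinearMap.det]
  set K1 := L * Real.exp (L * ε) with hK1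
  have hK1n : 0 ≤ K1 := by positivity
  have hev : ∀ᶠ t in 𝓝[Icc (0:ℝ) ε] (0:ℝ), K1 * t < r := by
    have : Tendsto (fun t : ℝ => K1 * t) (𝓝[Icc (0:ℝ) ε] (0:ℝ)) (𝓝 (K1 * 0)) :=
      ((continuous_const.mul continuous_id).tendsto 0).mono_left nhdsWithin_le_nhds
    rw [mul_zero] at this
    exact this.eventually (gt_mem_nhds hr)
  have hdet : ∀ t ∈ Icc (0 : ℝ) ε, K1 * t < r → ∀ X,
      |(|(fderiv ℝ (T t) X).det|) - 1| ≤ c * K1 * t := by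
    intro t ht htr X
    have h1 := hA t ht X
    have h2 := hball (y := fderiv ℝ (T t) X) (by rw [dist_eq_norm]; linarith)
    rw [hdetid, Real.norm_eq_abs] at h2
    have h3 := abs_abs_sub_abs_le_abs_sub (fderiv ℝ (T t) X).det 1
    rw [abs_one] at h3
    calc _ ≤ _ := h3
      _ ≤ _ := h2
      _ ≤ c * (K1 * t) := by gcongr
      _ = _ := by ring
  -- bound on displacement
  have hKc : IsCompact (Icc (0:ℝ) ε ×ˢ Metric.closedBall (0 : EuclideanSpace ℝ (Fin N)) M) :=
    isCompact_Icc.prod (isCompact_closedBall _ _)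
  obtain ⟨B, hB⟩ := hKc.exists_bound_of_continuousOn hVcont.continuousOn
  obtain ⟨BF, hBF⟩ := hKc.exists_bound_of_continuousOn hF.continuous.continuousOn
  obtain ⟨BD, hBD⟩ := hKc.exists_bound_of_continuousOn
    (hF.continuous_fderiv (by norm_num)).continuousOn
  have hmemK : ∀ t ∈ Icc (0:ℝ) ε, ∀ X ∈ Ω, (t, T t X) ∈
      (Icc (0:ℝ) ε ×ˢ Metric.closedBall (0 : EuclideanSpace ℝ (Fin N)) M) := fun t ht X hX =>
    ⟨ht, mem_closedBall_zero_iff.2 (hM t ht X (hΩR X hX))⟩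
  have hdisp : ∀ t ∈ Icc (0:ℝ) ε, ∀ X ∈ Ω, ‖T t X - X‖ ≤ B * t := by
    intro t ht X hX
    have := norm_image_sub_le_of_norm_deriv_le_segment' (hTflow X).2 (C := B)
      (fun s hs => hB (s, T s X) (hmemK s (Ico_subset_Icc_self hs) X hX)) t ht
    rwa [(hTflow X).1, sub_zero] at this
  have hFlip : ∀ t ∈ Icc (0:ℝ) ε, ∀ X ∈ Ω, |F t (T t X) - F 0 X| ≤ |BD| * ((1 + |B|) * t) := by
    intro t ht X hX
    have hconv : Convex ℝ (Icc (0:ℝ) ε ×ˢ Metric.closedBall (0 : EuclideanSpace ℝ (Fin N)) M) :=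
      (convex_Icc _ _).prod (convex_closedBall _ _)
    have h0 := hmemK 0 h0ε X hX
    have := hconv.norm_image_sub_le_of_norm_fderiv_le (𝕜 := ℝ)
      (fun p _ => (hF.differentiable (by norm_num)) p) (fun p hp => (hBD p hp).trans (le_abs_self _))
      h0 (hmemK t ht X hX)
    simp only [(hTflow X).1, Real.norm_eq_abs] at this
    refine this.trans (mul_le_mul_of_nonneg_left ?_ (abs_nonneg _))
    have ht0 := ht.1
    have hBt : B * t ≤ |B| * t := mul_le_mul_of_nonneg_right (le_abs_self _) ht0
    have hBt' : 0 ≤ |B| * t := by positivity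
    rw [Prod.mk_sub_mk, Prod.norm_mk, sub_zero, Real.norm_eq_abs, abs_of_nonneg ht0]
    refine max_le ?_ ?_
    · linarith
    · have := hdisp t ht X hX
      linarith
  -- the transported integrand
  let g : ℝ → EuclideanSpace ℝ (Fin N) → ℝ := fun t x => |(fderiv ℝ (T t) x).det| * F t (T t x)
  have hcov : ∀ t ∈ Icc (0:ℝ) ε, ∫ x in T t '' Ω, F t x = ∫ x in Ω, g t x := by
    intro t ht
    have := integral_image_eq_integral_abs_det_fderiv_smul volume hΩmeas (f := T t)
      (f' := fderiv ℝ (T t))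
      (fun x _ => ((hTC1 t ht).differentiable (by norm_num) x).hasFDerivAt.hasFDerivWithinAt)
      (flow_injective ε L hL V T hVlip hTflow t ht).injOn (F t)
    simpa [g] using this
  refine HasDerivWithinAt.congr_of_mem ?_ hcov h0ε
  have : IsFiniteMeasure (volume.restrict Ω) := ⟨by
    rw [Measure.restrict_apply_univ]
    exact hΩbdd.measure_lt_top⟩
  refine hasDerivWithinAt_integral_of_lip (Icc 0 ε) g _
    (c * K1 * |BF| + |BD| * (1 + |B|)) ?_ h0ε ?_ ?_
  · intro t ht
    have hgc : Continuous (g t) := by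
      have h1 := (hTC1 t ht).continuous_fderiv (by norm_num)
      have h2 := (hTC1 t ht).continuous
      have h3 : Continuous fun x => F t (T t x) :=
        hF.continuous.comp (continuous_const.prodMk h2)
      exact (ContinuousLinearMap.continuous_det.comp h1).abs.mul h3
    exact (hgc.continuousOn.integrableOn_compact
      (isCompact_closedBall (0 : EuclideanSpace ℝ (Fin N)) R0)).mono_set hR0
  · filter_upwards [hev, self_mem_nhdsWithin] with t htr ht
    refine (ae_restrict_mem hΩmeas).mono fun X hX => ?_
    have h1 := hdet t ht htr X
    have h2 := hFlip t ht X hX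
    have h3 : |F t (T t X)| ≤ |BF| := (hBF _ (hmemK t ht X hX)).trans (le_abs_self _)
    have hg0 : g 0 X = F 0 X := by
      simp only [g]
      rw [(hvar X).1, hdetid, (hTflow X).1, abs_one, one_mul]
    rw [hg0, abs_of_nonneg ht.1]
    have : g t X - F 0 X = (|(fderiv ℝ (T t) X).det| - 1) * F t (T t X)
        + (F t (T t X) - F 0 X) := by simp only [g]; ring
    rw [this]
    refine (abs_add_le _ _).trans ?_
    rw [abs_mul]
    have h4 := mul_le_mul h1 h3 (abs_nonneg _) (mul_nonneg (by positivity) ht.1)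
    linarith
  · refine Filter.Eventually.of_forall fun X => ?_
    have hdd : HasDerivWithinAt (fun t => (fderiv ℝ (T t) X).det)
        (LinearMap.trace ℝ (EuclideanSpace ℝ (Fin N))
              (fderiv ℝ (V 0) X :
                EuclideanSpace ℝ (Fin N) →ₗ[ℝ] EuclideanSpace ℝ (Fin N))) (Icc 0 ε) 0 := by
      have h1 := (hvar X).2.1 0 h0ε
      rw [(hvar X).1, (hTflow X).1, ContinuousLinearMap.comp_id] at h1
      have h2 : HasFDerivAt (fun A : EuclideanSpace ℝ (Fin N) →L[ℝ] EuclideanSpace ℝ (Fin N)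
        => A.det) D (fderiv ℝ (T 0) X) := by rw [(hvar X).1]; exact hD
      have h3 := h2.comp_hasDerivWithinAt (0:ℝ) h1
      rw [hDtr] at h3
      exact h3
    have habs : HasDerivWithinAt (fun t => |(fderiv ℝ (T t) X).det|)
        (LinearMap.trace ℝ (EuclideanSpace ℝ (Fin N))
              (fderiv ℝ (V 0) X :
                EuclideanSpace ℝ (Fin N) →ₗ[ℝ] EuclideanSpace ℝ (Fin N))) (Icc 0 ε) 0 := by
      have hpos : (0:ℝ) < (fderiv ℝ (T 0) X).det := by rw [(hvar X).1, hdetid]; norm_num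
      refine hdd.congr_of_eventuallyEq ?_ (abs_of_pos hpos)
      have h1 : ∀ᶠ t in 𝓝[Icc (0:ℝ) ε] (0:ℝ), 0 < (fderiv ℝ (T t) X).det :=
        hdd.continuousWithinAt.eventually (lt_mem_nhds hpos)
      filter_upwards [h1] with t ht using abs_of_pos ht
    have hFd : HasDerivWithinAt (fun t => F t (T t X))
        (deriv (fun s : ℝ => F s X) 0 + fderiv ℝ (F 0) X (V 0 X)) (Icc 0 ε) 0 := by
      have hFD := ((hF.differentiable (by norm_num)) (0, X)).hasFDerivAt
      have h1 := (hTflow X).2 0 h0ε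
      rw [(hTflow X).1] at h1
      have h2 := (hasDerivWithinAt_id (0:ℝ) (Icc 0 ε)).prodMk h1
      have hFD' : HasFDerivAt (fun p : ℝ × EuclideanSpace ℝ (Fin N) => F p.1 p.2)
        (fderiv ℝ (fun p : ℝ × EuclideanSpace ℝ (Fin N) => F p.1 p.2) (0, X))
        ((fun t => (id t, T t X)) (0:ℝ)) := by
        simp only [id, (hTflow X).1]; exact hFD
      have h3 := hFD'.comp_hasDerivWithinAt (0:ℝ) h2
      have e1 : deriv (fun s : ℝ => F s X) 0 =
          fderiv ℝ (fun p : ℝ × EuclideanSpace ℝ (Fin N) => F p.1 p.2) (0, X) (1, 0) := by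
        have h4 : HasDerivAt (fun s : ℝ => (s, X)) ((1:ℝ), (0 : EuclideanSpace ℝ (Fin N))) 0 :=
          (hasDerivAt_id (0:ℝ)).prodMk (hasDerivAt_const 0 X)
        have h5 := HasFDerivAt.comp_hasDerivAt (f := fun s : ℝ => (s, X)) (0:ℝ) hFD h4
        exact h5.deriv
      have e2 : fderiv ℝ (F 0) X = (fderiv ℝ (fun p : ℝ × EuclideanSpace ℝ (Fin N) => F p.1 p.2)
          (0, X)).comp (ContinuousLinearMap.inr ℝ ℝ (EuclideanSpace ℝ (Fin N))) :=
        (hFD.comp X (hasFDerivAt_prodMk_right (0:ℝ) X)).fderiv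
      have e3 : ((1:ℝ), V 0 X) = (1, 0) + (0, V 0 X) := by simp
      rw [e3, map_add] at h3
      rw [e1, e2]
      exact h3
    have h := habs.mul hFd
    rw [(hvar X).1, hdetid, (hTflow X).1, abs_one, one_mul] at h
    refine h.congr_deriv ?_
    ring
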